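/- arXiv:1105.4821 — 11 statements merged into one kernel-verified Lean document; each statement's English description precedes it below -/
import Mathlib

section
/- Let a, b, c be real numbers with a, b, c ≥ 0 and a + b + c > 0. The linear map Φ[a,b,c] on M₃(ℂ) is positive (i.e. maps every positive semidefinite matrix to a positive semidefinite matrix) if and only if a + b + c ≥ 2 and, in case a ≤ 1, additionally bc ≥ (1 − a)². -/
open scoped ComplexOrder

/-- The map `Φ[a,b,c]` on `M₃(ℂ)`. -/
noncomputable def Phi (a b c : ℝ) (X : Matrix (Fin 3) (Fin 3) ℂ) :
    Matrix (Fin 3) (Fin 3) ℂ :=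
  (((a + b + c)⁻¹ : ℝ) : ℂ) •
    (Matrix.diagonal
      (![((a : ℂ) + 1) * X 0 0 + (b : ℂ) * X 1 1 + (c : ℂ) * X 2 2,
        (c : ℂ) * X 0 0 + ((a : ℂ) + 1) * X 1 1 + (b : ℂ) * X 2 2,
        (b : ℂ) * X 0 0 + (c : ℂ) * X 1 1 + ((a : ℂ) + 1) * X 2 2] : Fin 3 → ℂ) - X)


lemma P_edge (a b c : ℝ) (ha : 0 ≤ a) (hb : 0 ≤ b) (hc : 0 ≤ c)
    (h : a ≤ 1 → (1 - a) ^ 2 ≤ b * c) (y z : ℝ) (hy : 0 ≤ y) (hz : 0 ≤ z) :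
    0 ≤ a * c * y ^ 2 + (a ^ 2 + b * c - 1) * (y * z) + a * b * z ^ 2 := by
  have hyz := mul_nonneg hy hz
  rcases le_total a 1 with h1 | h1
  · have hbc := h h1
    obtain ⟨β, hβ, rfl⟩ : ∃ β : ℝ, 0 ≤ β ∧ b = β ^ 2 := ⟨√b, by positivity, (Real.sq_sqrt hb).symm⟩
    obtain ⟨γ, hγ, rfl⟩ : ∃ β : ℝ, 0 ≤ β ∧ c = β ^ 2 := ⟨√c, by positivity, (Real.sq_sqrt hc).symm⟩
    have ht : 1 - a ≤ β * γ := by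
      by_contra! hlt
      nlinarith [mul_nonneg hβ hγ]
    have h2 : 0 ≤ (a + β * γ) ^ 2 - 1 := by nlinarith
    have h3 := mul_nonneg ha (sq_nonneg (γ * y - β * z))
    nlinarith [mul_nonneg h2 hyz]
  · have : 0 ≤ a ^ 2 + b * c - 1 := by nlinarith [mul_nonneg hb hc]
    positivity

lemma P_K (a b c : ℝ) (ha : 0 ≤ a) (hb : 0 ≤ b) (hc : 0 ≤ c) (hs : 2 ≤ a + b + c)
    (h : a ≤ 1 → (1 - a) ^ 2 ≤ b * c) :
    0 ≤ (a + b + c) * (a * b + b * c + c * a) - (b + c) := by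
  have hq := mul_nonneg hb hc
  rcases le_total a 1 with h1 | h1
  · have hbc := h h1
    have hm : 0 ≤ b + c := by positivity
    have h3 : 0 ≤ (b + c) + 2 * a - 2 := by linarith
    have := mul_nonneg (mul_nonneg ha hm) h3
    have := mul_nonneg ha hq
    have := mul_nonneg hm (sub_nonneg.2 hbc)
    nlinarith
  · have hm : 0 ≤ b + c := by positivity
    have : b + c ≤ a * b + b * c + c * a := by nlinarith
    nlinarith

lemma P_min (a b c : ℝ) (ha : 0 ≤ a) (hb : 0 ≤ b) (hc : 0 ≤ c) (hs : 2 ≤ a + b + c)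
    (h : a ≤ 1 → (1 - a) ^ 2 ≤ b * c) (x p q : ℝ) (hx : 0 ≤ x) (hp : 0 ≤ p) (hq : 0 ≤ q) :
    x * (x + p) * (b * x + c * (x + p) + a * (x + q))
     + x * (x + q) * (c * x + a * (x + p) + b * (x + q))
     + (x + p) * (x + q) * (a * x + b * (x + p) + c * (x + q)) + 2 * (x * (x + p) * (x + q))
     ≤ (a * x + b * (x + p) + c * (x + q)) * (c * x + a * (x + p) + b * (x + q)) *
       (b * x + c * (x + p) + a * (x + q)) := by
  have hE := mul_nonneg (add_nonneg (mul_nonneg hb hp) (mul_nonneg hc hq))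
    (P_edge a b c ha hb hc h p q hp hq)
  have hK := mul_nonneg hx (mul_nonneg (P_K a b c ha hb hc hs h)
    (show 0 ≤ p ^ 2 - p * q + q ^ 2 by nlinarith [sq_nonneg (p - q), mul_nonneg hp hq]))
  have hF : 0 ≤ (a + b + c - 2) * (a + b + c + 1) ^ 2 := mul_nonneg (by linarith) (sq_nonneg _)
  have hF2 : 0 ≤ x ^ 3 + x ^ 2 * (p + q) + x * (p * q) := by positivity
  have hF3 := mul_nonneg hF hF2
  linear_combination hE + hK + hF3

lemma P_poly (a b c : ℝ) (ha : 0 ≤ a) (hb : 0 ≤ b) (hc : 0 ≤ c) (hs : 2 ≤ a + b + c)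
    (h : a ≤ 1 → (1 - a) ^ 2 ≤ b * c) (x y z : ℝ) (hx : 0 ≤ x) (hy : 0 ≤ y) (hz : 0 ≤ z) :
    x * y * (b * x + c * y + a * z) + x * z * (c * x + a * y + b * z)
     + y * z * (a * x + b * y + c * z) + 2 * (x * y * z)
     ≤ (a * x + b * y + c * z) * (c * x + a * y + b * z) * (b * x + c * y + a * z) := by
  have key := P_min a b c ha hb hc hs h
  by_cases h1 : x ≤ y ∧ x ≤ z
  · have := key x (y - x) (z - x) hx (by linarith) (by linarith)
    simp only [add_sub_cancel] at this
    linarith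
  by_cases h2 : y ≤ z ∧ y ≤ x
  · have := key y (z - y) (x - y) hy (by linarith) (by linarith)
    simp only [add_sub_cancel] at this
    linarith
  have h3 : z ≤ x ∧ z ≤ y := by grind
  have := key z (x - z) (y - z) hz (by linarith) (by linarith)
  simp only [add_sub_cancel] at this
  linarith

lemma P_two (a b c : ℝ) (ha : 0 ≤ a) (hb : 0 ≤ b) (hc : 0 ≤ c)
    (h : a ≤ 1 → (1 - a) ^ 2 ≤ b * c) (y z : ℝ) (hy : 0 ≤ y) (hz : 0 ≤ z) :
    y / ((a + 1) * y + b * z) + z / (c * y + (a + 1) * z) ≤ 1 := by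
  have e := P_edge a b c ha hb hc h y z hy hz
  rcases hy.eq_or_lt with rfl | hy
  · simp only [zero_div, zero_add, mul_zero]
    exact div_le_one_of_le₀ (by nlinarith) (by positivity)
  rcases hz.eq_or_lt with rfl | hz
  · simp only [zero_div, add_zero, mul_zero]
    exact div_le_one_of_le₀ (by nlinarith) (by positivity)
  rw [div_add_div _ _ (by positivity) (by positivity), div_le_one (by positivity)]
  linear_combination e

lemma P_three (a b c : ℝ) (ha : 0 ≤ a) (hb : 0 ≤ b) (hc : 0 ≤ c) (hs : 2 ≤ a + b + c)
    (h : a ≤ 1 → (1 - a) ^ 2 ≤ b * c) (x y z : ℝ) (hx : 0 ≤ x) (hy : 0 ≤ y) (hz : 0 ≤ z) :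
    x / ((a + 1) * x + b * y + c * z) + y / (c * x + (a + 1) * y + b * z)
      + z / (b * x + c * y + (a + 1) * z) ≤ 1 := by
  have e := P_poly a b c ha hb hc hs h x y z hx hy hz
  have t := P_two a b c ha hb hc h
  rcases hx.eq_or_lt with rfl | hx
  · simpa using t y z hy hz
  rcases hy.eq_or_lt with rfl | hy
  · have := t z x hz hx.le
    simp only [zero_div, add_zero, mul_zero]
    rw [add_comm (b * x), add_comm ((a+1) * x), add_comm (x / _)]
    exact this
  rcases hz.eq_or_lt with rfl | hz
  · simpa using t x y hx.le hy.le
  rw [div_add_div _ _ (by positivity) (by positivity),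
    div_add_div _ _ (by positivity) (by positivity), div_le_one (by positivity)]
  linear_combination e

lemma P_cs (a b c : ℝ) (ha : 0 ≤ a) (hb : 0 ≤ b) (hc : 0 ≤ c) (hs : 2 ≤ a + b + c)
    (h : a ≤ 1 → (1 - a) ^ 2 ≤ b * c) (r s : Fin 3 → ℝ) :
    (r 0 * s 0 + r 1 * s 1 + r 2 * s 2) ^ 2 ≤
     ((a + 1) * r 0 ^ 2 + b * r 1 ^ 2 + c * r 2 ^ 2) * s 0 ^ 2
     + (c * r 0 ^ 2 + (a + 1) * r 1 ^ 2 + b * r 2 ^ 2) * s 1 ^ 2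
     + (b * r 0 ^ 2 + c * r 1 ^ 2 + (a + 1) * r 2 ^ 2) * s 2 ^ 2 := by
  have e := P_three a b c ha hb hc hs h (r 0 ^ 2) (r 1 ^ 2) (r 2 ^ 2) (by positivity)
    (by positivity) (by positivity)
  set d : Fin 3 → ℝ := ![(a + 1) * r 0 ^ 2 + b * r 1 ^ 2 + c * r 2 ^ 2,
    c * r 0 ^ 2 + (a + 1) * r 1 ^ 2 + b * r 2 ^ 2, b * r 0 ^ 2 + c * r 1 ^ 2 + (a + 1) * r 2 ^ 2] with hd
  have hr : ∀ i, r i ^ 2 ≤ d i := by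
    intro i
    have h0 := sq_nonneg (r 0)
    have h1 := sq_nonneg (r 1)
    have h2 := sq_nonneg (r 2)
    fin_cases i <;> simp [hd] <;> 
      nlinarith [mul_nonneg ha h0, mul_nonneg ha h1, mul_nonneg ha h2, mul_nonneg hb h0,
        mul_nonneg hb h1, mul_nonneg hb h2, mul_nonneg hc h0, mul_nonneg hc h1, mul_nonneg hc h2]
  have hd0 : ∀ i, 0 ≤ d i := fun i => (sq_nonneg _).trans (hr i)
  have := Finset.sum_sq_le_sum_mul_sum_of_sq_le_mul Finset.univ (r := fun i => r i * s i)
    (f := fun i => r i ^ 2 / d i) (g := fun i => d i * s i ^ 2)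
    (fun i _ => div_nonneg (sq_nonneg _) (hd0 i)) (fun i _ => mul_nonneg (hd0 i) (sq_nonneg _))
    (fun i _ => le_of_eq <| by
      rcases (hd0 i).eq_or_lt with h0 | h0
      · have : r i = 0 := by
          have := hr i
          rw [← h0] at this
          exact pow_eq_zero_iff (two_ne_zero) |>.1 (le_antisymm this (sq_nonneg _))
        simp [this]
      · field_simp)
  have e' : ∑ i, r i ^ 2 / d i ≤ 1 := by simpa [Fin.sum_univ_three, hd] using e
  have h2 : 0 ≤ ∑ i, d i * s i ^ 2 :=
    Finset.sum_nonneg (fun i _ => mul_nonneg (hd0 i) (sq_nonneg _))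
  have h3 := this.trans (mul_le_mul_of_nonneg_right e' h2)
  simpa [Fin.sum_univ_three, hd] using h3

lemma P_herm (a b c : ℝ) (X : Matrix (Fin 3) (Fin 3) ℂ) (hX : X.IsHermitian) :
    (Phi a b c X).IsHermitian := by
  have h : ∀ i j, (starRingEnd ℂ) (X i j) = X j i := fun i j => hX.apply j i
  ext i j
  fin_cases i <;> fin_cases j <;> simp [Phi, Matrix.diagonal, h]

lemma P_quad (a b c : ℝ) (v w : Fin 3 → ℂ) :
    star w ⬝ᵥ (Phi a b c (Matrix.vecMulVec v (star v))).mulVec w =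
    (((a + b + c)⁻¹ * (
     ((a + 1) * ‖v 0‖ ^ 2 + b * ‖v 1‖ ^ 2 + c * ‖v 2‖ ^ 2) * ‖w 0‖ ^ 2
     + (c * ‖v 0‖ ^ 2 + (a + 1) * ‖v 1‖ ^ 2 + b * ‖v 2‖ ^ 2) * ‖w 1‖ ^ 2
     + (b * ‖v 0‖ ^ 2 + c * ‖v 1‖ ^ 2 + (a + 1) * ‖v 2‖ ^ 2) * ‖w 2‖ ^ 2
     - ‖star (v 0) * w 0 + star (v 1) * w 1 + star (v 2) * w 2‖ ^ 2) : ℝ) : ℂ) := by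
  push_cast
  simp only [← Complex.conj_mul', Phi, dotProduct, Matrix.mulVec, Fin.sum_univ_three]
  simp [Matrix.diagonal, Matrix.vecMulVec]
  ring

lemma P_rank1 (a b c : ℝ) (ha : 0 ≤ a) (hb : 0 ≤ b) (hc : 0 ≤ c) (hs : 2 ≤ a + b + c)
    (h : a ≤ 1 → (1 - a) ^ 2 ≤ b * c) (v : Fin 3 → ℂ) :
    (Phi a b c (Matrix.vecMulVec v (star v))).PosSemidef := by
  refine Matrix.PosSemidef.of_dotProduct_mulVec_nonneg
    (P_herm a b c _ (Matrix.posSemidef_vecMulVec_self_star v).isHermitian) (fun w => ?_)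
  rw [P_quad, Complex.zero_le_real]
  have h1 := P_cs a b c ha hb hc hs h (fun i => ‖v i‖) (fun i => ‖w i‖)
  have h2 : ‖star (v 0) * w 0 + star (v 1) * w 1 + star (v 2) * w 2‖ ≤
      ‖v 0‖ * ‖w 0‖ + ‖v 1‖ * ‖w 1‖ + ‖v 2‖ * ‖w 2‖ := by
    refine (norm_add₃_le).trans (le_of_eq ?_)
    simp
  have h3 := pow_le_pow_left₀ (norm_nonneg _) h2 2
  exact mul_nonneg (inv_nonneg.2 (by linarith)) (by linarith)

lemma P_add (a b c : ℝ) (X Y : Matrix (Fin 3) (Fin 3) ℂ) :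
    Phi a b c (X + Y) = Phi a b c X + Phi a b c Y := by
  ext i j
  fin_cases i <;> fin_cases j <;> simp [Phi, Matrix.diagonal] <;> ring

lemma P_decomp (X : Matrix (Fin 3) (Fin 3) ℂ) (hX : X.PosSemidef) :
    ∃ u v w : Fin 3 → ℂ, X = Matrix.vecMulVec u (star u) + Matrix.vecMulVec v (star v)
      + Matrix.vecMulVec w (star w) := by
  open scoped MatrixOrder Matrix.Norms.L2Operator in
  obtain ⟨B, rfl⟩ := CStarAlgebra.nonneg_iff_eq_star_mul_self.mp hX.nonneg
  refine ⟨star (B 0), star (B 1), star (B 2), ?_⟩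
  ext i j
  simp [Matrix.mul_apply, Fin.sum_univ_three, Matrix.vecMulVec, Matrix.star_apply]

lemma P_test (a b c : ℝ) (hsum : 0 < a + b + c)
    (H : ∀ X : Matrix (Fin 3) (Fin 3) ℂ, X.PosSemidef → (Phi a b c X).PosSemidef)
    (r s : Fin 3 → ℝ) :
    (r 0 * s 0 + r 1 * s 1 + r 2 * s 2) ^ 2 ≤
     ((a + 1) * r 0 ^ 2 + b * r 1 ^ 2 + c * r 2 ^ 2) * s 0 ^ 2
     + (c * r 0 ^ 2 + (a + 1) * r 1 ^ 2 + b * r 2 ^ 2) * s 1 ^ 2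
     + (b * r 0 ^ 2 + c * r 1 ^ 2 + (a + 1) * r 2 ^ 2) * s 2 ^ 2 := by
  have := (H _ (Matrix.posSemidef_vecMulVec_self_star (fun i => (r i : ℂ)))).dotProduct_mulVec_nonneg
    (fun i => (s i : ℂ))
  rw [P_quad, Complex.zero_le_real] at this
  have h2 := nonneg_of_mul_nonneg_right this (inv_pos.2 hsum)
  have e : star (r 0 : ℂ) * (s 0 : ℂ) + star (r 1 : ℂ) * s 1 + star (r 2 : ℂ) * s 2
    = ((r 0 * s 0 + r 1 * s 1 + r 2 * s 2 : ℝ) : ℂ) := by simp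
  rw [e] at h2
  simp only [Complex.norm_real, Real.norm_eq_abs, sq_abs] at h2
  linarith

/-- for `a, b, c ≥ 0` with `a + b + c > 0`, the map `Φ[a,b,c]` is
positive iff `a + b + c ≥ 2` and, in case `a ≤ 1`, additionally `bc ≥ (1−a)²`. -/
theorem stmt0 (a b c : ℝ) (ha : 0 ≤ a) (hb : 0 ≤ b) (hc : 0 ≤ c)
    (hsum : 0 < a + b + c) :
    (∀ X : Matrix (Fin 3) (Fin 3) ℂ, X.PosSemidef → (Phi a b c X).PosSemidef) ↔
      (2 ≤ a + b + c ∧ (a ≤ 1 → (1 - a) ^ 2 ≤ b * c)) := by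
  constructor
  · intro H
    have T := P_test a b c hsum H
    refine ⟨?_, fun h1 => ?_⟩
    · have := T (fun _ => 1) (fun _ => 1)
      norm_num at this
      linarith
    · have key : ∀ ε : ℝ, 0 < ε → (1 - a) ^ 2 ≤ (b + ε) * (c + ε) := by
        intro ε hε
        obtain ⟨m, hm, hbm⟩ : ∃ m : ℝ, 0 < m ∧ b + ε = m ^ 4 :=
          ⟨√(√(b + ε)), by positivity, by
            rw [show (4 : ℕ) = 2 * 2 from rfl, pow_mul, Real.sq_sqrt (by positivity),
              Real.sq_sqrt (by positivity)]⟩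
        obtain ⟨n, hn, hcn⟩ : ∃ m : ℝ, 0 < m ∧ c + ε = m ^ 4 :=
          ⟨√(√(c + ε)), by positivity, by
            rw [show (4 : ℕ) = 2 * 2 from rfl, pow_mul, Real.sq_sqrt (by positivity),
              Real.sq_sqrt (by positivity)]⟩
        have t := T ![m, n, 0] ![n, m, 0]
        simp at t
        have hb' : b * (n ^ 2 * n ^ 2) ≤ m ^ 4 * (n ^ 2 * n ^ 2) :=
          mul_le_mul_of_nonneg_right (by linarith) (by positivity)
        have hc' : c * (m ^ 2 * m ^ 2) ≤ n ^ 4 * (m ^ 2 * m ^ 2) :=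
          mul_le_mul_of_nonneg_right (by linarith) (by positivity)
        have h2 : 0 ≤ (m ^ 2 * n ^ 2) * (a + m ^ 2 * n ^ 2 - 1) := by nlinarith
        have h3 := nonneg_of_mul_nonneg_right h2 (by positivity)
        rw [hbm, hcn, show m ^ 4 * n ^ 4 = (m ^ 2 * n ^ 2) ^ 2 by ring]
        exact pow_le_pow_left₀ (by linarith) (by linarith) 2
      have ht : Filter.Tendsto (fun ε : ℝ => (b + ε) * (c + ε)) (nhdsWithin 0 (Set.Ioi 0))
          (nhds (b * c)) := by
        have : Continuous (fun ε : ℝ => (b + ε) * (c + ε)) := by fun_prop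
        have h0 := this.tendsto 0
        simp only [add_zero] at h0
        exact h0.mono_left nhdsWithin_le_nhds
      exact ge_of_tendsto ht (by
        filter_upwards [self_mem_nhdsWithin] with ε hε using key ε hε)
  · rintro ⟨hs, h⟩ X hX
    obtain ⟨u, v, w, rfl⟩ := P_decomp X hX
    rw [P_add, P_add]
    have R := P_rank1 a b c ha hb hc hs h
    exact ((R u).add (R v)).add (R w)
end

section
/- Let a, b, c be real numbers with b, c ≥ 0 and a + b + c > 0. The 9×9 matrix W[a,b,c] is positive semidefinite if and only if a ≥ 2. (Equivalently, the map Φ[a,b,c], whose Choi matrix is W[a,b,c], is completely positive if and only if a ≥ 2.) -/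
open scoped ComplexOrder

/-- The entanglement witness `W[a,b,c]` as a `9 × 9` matrix indexed by pairs
`(i,j)` with `i, j ∈ Fin 3` (cyclic indices): the nonzero entries are
`W[(i,i),(i,i)] = aN/3`, `W[(i,i+1),(i,i+1)] = bN/3`, `W[(i,i+2),(i,i+2)] = cN/3`
and `W[(i,i),(j,j)] = −N/3` for `i ≠ j`, where `N = 1/(a+b+c)`. -/
noncomputable def Wmat (a b c : ℝ) : Matrix (Fin 3 × Fin 3) (Fin 3 × Fin 3) ℂ :=
  Matrix.of fun p q =>
    if p = q then
      (if p.2 = p.1 then ((a / (a + b + c) / 3 : ℝ) : ℂ)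
       else if p.2 = p.1 + 1 then ((b / (a + b + c) / 3 : ℝ) : ℂ)
       else ((c / (a + b + c) / 3 : ℝ) : ℂ))
    else if p.2 = p.1 ∧ q.2 = q.1 then ((-(1 / (a + b + c)) / 3 : ℝ) : ℂ) else 0

/-- Difference of two diagonal basis vectors. -/
def dv (i j : Fin 3) : Fin 3 × Fin 3 → ℂ := fun p =>
  if p = (i, i) then 1 else if p = (j, j) then -1 else 0

lemma W_decomp (a b c : ℝ) : Wmat a b c =
    (1 / (a + b + c) / 3 : ℝ) • (Matrix.diagonal (fun p : Fin 3 × Fin 3 =>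
      if p.2 = p.1 then ((a - 2 : ℝ) : ℂ) else if p.2 = p.1 + 1 then (b : ℂ) else (c : ℂ))
      + Matrix.vecMulVec (dv 0 1) (star (dv 0 1))
      + Matrix.vecMulVec (dv 1 2) (star (dv 1 2))
      + Matrix.vecMulVec (dv 0 2) (star (dv 0 2))) := by
  ext ⟨i, j⟩ ⟨k, l⟩
  fin_cases i <;> fin_cases j <;> fin_cases k <;> fin_cases l <;>
    simp [Wmat, dv, Matrix.vecMulVec_apply, Matrix.diagonal_apply] <;> ring

/-- for `b, c ≥ 0` with `a + b + c > 0`, the matrix `W[a,b,c]`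
is positive semidefinite iff `a ≥ 2`. -/
theorem stmt1 (a b c : ℝ) (hb : 0 ≤ b) (hc : 0 ≤ c) (hsum : 0 < a + b + c) :
    (Wmat a b c).PosSemidef ↔ 2 ≤ a := by
  constructor
  · intro h
    have h1 := h.dotProduct_mulVec_nonneg (fun p => if p.2 = p.1 then 1 else 0)
    have h2 : dotProduct (star (fun p : Fin 3 × Fin 3 => if p.2 = p.1 then (1 : ℂ) else 0))
        ((Wmat a b c).mulVec (fun p => if p.2 = p.1 then 1 else 0))
        = (((a - 2) / (a + b + c) : ℝ) : ℂ) := by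
      simp [dotProduct, Matrix.mulVec, Fintype.sum_prod_type, Fin.sum_univ_three, Wmat]
      ring
    rw [h2, Complex.zero_le_real] at h1
    by_contra! hlt
    exact absurd h1 (not_le.mpr (div_neg_of_neg_of_pos (by linarith) hsum))
  · intro h
    rw [W_decomp]
    refine Matrix.PosSemidef.smul ?_ (by positivity)
    refine (((Matrix.PosSemidef.diagonal ?_).add ?_).add ?_).add ?_
    · intro p
      simp only [Pi.zero_apply]
      split_ifs
      · exact Complex.zero_le_real.mpr (by linarith)
      · exact Complex.zero_le_real.mpr hb
      · exact Complex.zero_le_real.mpr hc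
    all_goals exact Matrix.posSemidef_vecMulVec_self_star _
end

section
/- Let a, b, c be real numbers with a, b, c ≥ 0, 0 ≤ a < 2, a + b + c ≥ 2, and bc ≥ (1 − a)² in case a ≤ 1. Then the entanglement witness W[a,b,c] is decomposable, i.e. W[a,b,c] = P + Q^Γ for some positive semidefinite 9×9 matrices P and Q, if and only if bc ≥ (2 − a)²/4. -/
open scoped ComplexOrder

/-- Partial transposition (with respect to the second factor):
`(X^Γ)[(i,j),(k,l)] = X[(i,l),(k,j)]`. -/
def ptrans (X : Matrix (Fin 3 × Fin 3) (Fin 3 × Fin 3) ℂ) :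
    Matrix (Fin 3 × Fin 3) (Fin 3 × Fin 3) ℂ :=
  Matrix.of fun p q => X (p.1, q.2) (q.1, p.2)

noncomputable def auxV (x y : ℝ) (p0 p1 : Fin 3 × Fin 3) : Fin 3 × Fin 3 → ℂ :=
  fun p => if p = p0 then (x : ℂ) else if p = p1 then (y : ℂ) else 0

noncomputable def auxM (k x y : ℝ) (p0 p1 : Fin 3 × Fin 3) :
    Matrix (Fin 3 × Fin 3) (Fin 3 × Fin 3) ℂ :=
  (k : ℂ) • Matrix.vecMulVec (auxV x y p0 p1) (star (auxV x y p0 p1))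

lemma auxM_psd (k x y : ℝ) (hk : 0 ≤ k) (p0 p1 : Fin 3 × Fin 3) :
    (auxM k x y p0 p1).PosSemidef := by
  unfold auxM
  exact (Matrix.posSemidef_vecMulVec_self_star _).smul (by exact_mod_cast hk)

lemma auxM_apply (k x y : ℝ) (p0 p1 p q : Fin 3 × Fin 3) :
    auxM k x y p0 p1 p q = ((k * ((if p = p0 then x else if p = p1 then y else 0) *
      (if q = p0 then x else if q = p1 then y else 0)) : ℝ) : ℂ) := by
  simp only [auxM, auxV, Matrix.smul_apply, Matrix.vecMulVec_apply, Pi.star_apply, smul_eq_mul]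
  split_ifs <;> simp

lemma psd_pair (Q : Matrix (Fin 3 × Fin 3) (Fin 3 × Fin 3) ℂ) (hQ : Q.PosSemidef)
    (p q : Fin 3 × Fin 3) (hpq : p ≠ q) (x y : ℝ) :
    0 ≤ x ^ 2 * (Q p p).re + y ^ 2 * (Q q q).re + 2 * x * y * (Q p q).re := by
  have h := (hQ.submatrix ![p, q]).dotProduct_mulVec_nonneg ![(x : ℂ), (y : ℂ)]
  have h' := (Complex.le_def.1 h).1
  have hs : (Q q p).re = (Q p q).re := by
    rw [← hQ.1.apply p q]; simp
  simp [dotProduct, Matrix.mulVec, Fin.sum_univ_two] at h'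
  rw [hs] at h'
  linarith

lemma psd_triple (P : Matrix (Fin 3 × Fin 3) (Fin 3 × Fin 3) ℂ) (hP : P.PosSemidef) :
    0 ≤ (P (0,0) (0,0)).re + (P (1,1) (1,1)).re + (P (2,2) (2,2)).re
      + 2 * ((P (0,0) (1,1)).re + (P (1,1) (2,2)).re + (P (2,2) (0,0)).re) := by
  have h := (hP.submatrix ![((0 : Fin 3), (0 : Fin 3)), (1,1), (2,2)]).dotProduct_mulVec_nonneg
    ![(1 : ℂ), 1, 1]
  have h' := (Complex.le_def.1 h).1
  have hs : ∀ p q, (P q p).re = (P p q).re := by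
    intro p q
    rw [← hP.1.apply p q]; simp
  simp [dotProduct, Matrix.mulVec, Fin.sum_univ_three] at h'
  rw [hs (0,0) (1,1), hs (1,1) (2,2), hs (2,2) (0,0)] at h'
  linarith

/-- under `0 ≤ a < 2`, `b, c ≥ 0`, `a + b + c ≥ 2` and
`bc ≥ (1−a)²` whenever `a ≤ 1`, the witness `W[a,b,c]` is decomposable iff
`bc ≥ (2−a)²/4`. -/
theorem stmt2 (a b c : ℝ) (ha0 : 0 ≤ a) (ha2 : a < 2) (hb : 0 ≤ b) (hc : 0 ≤ c)
    (hsum : 2 ≤ a + b + c) (hell : a ≤ 1 → (1 - a) ^ 2 ≤ b * c) :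
    (∃ P Q : Matrix (Fin 3 × Fin 3) (Fin 3 × Fin 3) ℂ,
        P.PosSemidef ∧ Q.PosSemidef ∧ Wmat a b c = P + ptrans Q) ↔
      (2 - a) ^ 2 / 4 ≤ b * c := by
  have hpos : 0 < a + b + c := by linarith
  constructor
  · rintro ⟨P, Q, hP, hQ, hW⟩
    have e : ∀ i j k l : Fin 3, (Wmat a b c (i,j) (k,l)).re
        = (P (i,j) (k,l)).re + (Q (i,l) (k,j)).re := by
      intro i j k l
      rw [hW]; simp [ptrans]
    have hPd : ∀ p, 0 ≤ (P p p).re := fun p => (Complex.le_def.1 hP.diag_nonneg).1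
    have hQd : ∀ p, 0 ≤ (Q p p).re := fun p => (Complex.le_def.1 hQ.diag_nonneg).1
    have e00 := e 0 0 0 0
    have e11 := e 1 1 1 1
    have e22 := e 2 2 2 2
    have f01 := e 0 0 1 1
    have f12 := e 1 1 2 2
    have f20 := e 2 2 0 0
    have g01 := e 0 1 0 1
    have g12 := e 1 2 1 2
    have g20 := e 2 0 2 0
    have g10 := e 1 0 1 0
    have g21 := e 2 1 2 1
    have g02 := e 0 2 0 2
    simp only [Wmat, Matrix.of_apply] at e00 e11 e22 f01 f12 f20 g01 g12 g20 g10 g21 g02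
    simp [-Complex.ofReal_div, -Complex.ofReal_neg] at e00 e11 e22 f01 f12 f20 g01 g12 g20 g10 g21 g02
    have ht := psd_triple P hP
    have key : ∀ x y : ℝ, 0 ≤ x → 0 ≤ y → 0 ≤ b * x ^ 2 + c * y ^ 2 - (2 - a) * (x * y) := by
      intro x y hx hy
      have h1 := psd_pair Q hQ (0,1) (1,0) (by decide) x y
      have h2 := psd_pair Q hQ (1,2) (2,1) (by decide) x y
      have h3 := psd_pair Q hQ (2,0) (0,2) (by decide) x y
      have hS : (Q (0,1) (1,0)).re + (Q (1,2) (2,1)).re + (Q (2,0) (0,2)).re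
          ≤ (a - 2) * (a + b + c)⁻¹ / 2 := by
        have d0 := hQd (0,0)
        have d1 := hQd (1,1)
        have d2 := hQd (2,2)
        simp only [div_eq_mul_inv, one_mul] at *
        linarith
      have hB : (Q (0,1) (0,1)).re + (Q (1,2) (1,2)).re + (Q (2,0) (2,0)).re
          ≤ b * (a + b + c)⁻¹ := by
        have d0 := hPd (0,1)
        have d1 := hPd (1,2)
        have d2 := hPd (2,0)
        simp only [div_eq_mul_inv, one_mul] at *
        linarith
      have hC : (Q (1,0) (1,0)).re + (Q (2,1) (2,1)).re + (Q (0,2) (0,2)).re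
          ≤ c * (a + b + c)⁻¹ := by
        have d0 := hPd (1,0)
        have d1 := hPd (2,1)
        have d2 := hPd (0,2)
        simp only [div_eq_mul_inv, one_mul] at *
        linarith
      have m1 := mul_le_mul_of_nonneg_left hB (sq_nonneg x)
      have m2 := mul_le_mul_of_nonneg_left hC (sq_nonneg y)
      have m3 := mul_le_mul_of_nonneg_left hS (mul_nonneg hx hy)
      have h : 0 ≤ (b * x ^ 2 + c * y ^ 2 - (2 - a) * (x * y)) * (a + b + c)⁻¹ := by
        linarith
      exact nonneg_of_mul_nonneg_left h (inv_pos.2 hpos)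
    rcases hb.eq_or_lt with h0 | h0
    · have := key (c + 1) (2 - a) (by linarith) (by linarith)
      subst h0
      have : 0 < (2 - a) ^ 2 := by apply pow_pos; linarith
      nlinarith
    · have := key (2 - a) (2 * b) (by linarith) (by linarith)
      have h4 : 0 ≤ b * (4 * (b * c) - (2 - a) ^ 2) := by linarith
      have := nonneg_of_mul_nonneg_right h4 h0
      linarith
  · intro h
    have hs : 0 < (2 - a) ^ 2 := by apply pow_pos; linarith
    have hb0 : 0 < b := by
      rcases hb.eq_or_lt with h0 | h0
      · subst h0; linarith
      · exact h0
    set r := 1 / (3 * (a + b + c)) with hr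
    have hr0 : 0 < r := by positivity
    set s := (2 - a) / 2 with hsd
    have hd : 0 ≤ c - s ^ 2 / b := by
      rw [sub_nonneg, div_le_iff₀ hb0, hsd]; linarith
    have wa : a / (a + b + c) / 3 = r * a := by rw [hr]; field_simp
    have wb : b / (a + b + c) / 3 = r * b := by rw [hr]; field_simp
    have wc : c / (a + b + c) / 3 = r * c := by rw [hr]; field_simp
    have w1 : -(1 / (a + b + c)) / 3 = -r := by rw [hr]; field_simp
    refine ⟨∑ i : Fin 3, auxM (r * (a / 2)) 1 (-1) (i, i) (i + 1, i + 1),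
      ∑ i : Fin 3, (auxM (r / b) b (-s) (i, i + 1) (i + 1, i)
        + auxM (r * (c - s ^ 2 / b)) 0 1 (i, i + 1) (i + 1, i)), ?_, ?_, ?_⟩
    · exact Matrix.posSemidef_sum _ fun i _ => auxM_psd _ _ _ (by positivity) _ _
    · exact Matrix.posSemidef_sum _ fun i _ =>
        (auxM_psd _ _ _ (by positivity) _ _).add (auxM_psd _ _ _ (by positivity) _ _)
    · have k1 : r / b * (b * b) = r * b := by field_simp
      have k2 : r / b * (b * s) = r * s := by field_simp
      have k2' : r / b * (s * b) = r * s := by field_simp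
      have k3 : r / b * (s * s) + r * (c - s ^ 2 / b) = r * c := by field_simp; ring
      ext ⟨i, j⟩ ⟨k, l⟩
      simp only [Wmat, ptrans, Matrix.of_apply, Matrix.add_apply, Fin.sum_univ_three, auxM_apply,
        wa, wb, wc, w1]
      fin_cases i <;> fin_cases j <;> fin_cases k <;> fin_cases l <;>
        simp [-Complex.ofReal_mul, -Complex.ofReal_add, -Complex.ofReal_sub, -Complex.ofReal_div, -Complex.ofReal_neg, -Complex.ofReal_pow] <;> norm_cast <;> (try simp only [k1, k2, k2', k3]) <;> (try rw [hsd]) <;> ring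
end

section
/- Let b, c ≥ 0 and set a = 2 − b − c, assuming a ≥ 0 and bc ≥ (1 − a)² in case a ≤ 1 (so that Φ[a,b,c] is positive). Then the entanglement witness W[a,b,c] is decomposable, i.e. W[a,b,c] = P + Q^Γ for some positive semidefinite 9×9 matrices P and Q, if and only if b = c, which is precisely the condition that the map Φ[a,b,c] is self-dual (equals Φ[a,c,b]). -/
open scoped ComplexOrder

/-- Real vector supported on two indices. -/
noncomputable def vv (p q : Fin 3 × Fin 3) (x y : ℂ) : Fin 3 × Fin 3 → ℂ :=
  fun r => if r = p then x else if r = q then y else 0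

noncomputable def rk (p q : Fin 3 × Fin 3) : Matrix (Fin 3 × Fin 3) (Fin 3 × Fin 3) ℂ :=
  Matrix.vecMulVec (vv p q 1 (-1)) (star (vv p q 1 (-1)))

lemma rk_psd (p q : Fin 3 × Fin 3) : (rk p q).PosSemidef :=
  Matrix.posSemidef_vecMulVec_self_star _

lemma real_re (M : Matrix (Fin 3 × Fin 3) (Fin 3 × Fin 3) ℂ) (hM : M.PosSemidef)
    (v : Fin 3 × Fin 3 → ℂ) : 0 ≤ (star v ⬝ᵥ (M.mulVec v)).re := by
  have := hM.dotProduct_mulVec_nonneg v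
  exact (Complex.le_def.1 this).1

lemma psd_diag (M : Matrix (Fin 3 × Fin 3) (Fin 3 × Fin 3) ℂ) (hM : M.PosSemidef)
    (p : Fin 3 × Fin 3) : 0 ≤ (M p p).re := by
  exact (Complex.le_def.1 (hM.diag_nonneg (i := p))).1

lemma psd_two (M : Matrix (Fin 3 × Fin 3) (Fin 3 × Fin 3) ℂ) (hM : M.PosSemidef)
    (p q : Fin 3 × Fin 3) (t : ℝ) :
    0 ≤ t ^ 2 * (M p p).re + t * ((M p q).re + (M q p).re) + (M q q).re := by
  have h := real_re M hM (Pi.single p (t : ℂ) + Pi.single q 1)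
  have e : star (Pi.single p (t : ℂ) + Pi.single q 1 : Fin 3 × Fin 3 → ℂ)
      = Pi.single p (t : ℂ) + Pi.single q 1 := by
    rw [star_add, ← Pi.single_star, ← Pi.single_star]; simp
  rw [e] at h
  simp [Matrix.mulVec_add, add_dotProduct] at h
  nlinarith [h]

lemma psd_three (M : Matrix (Fin 3 × Fin 3) (Fin 3 × Fin 3) ℂ) (hM : M.PosSemidef) :
    0 ≤ ∑ i : Fin 3, ∑ j : Fin 3, (M (i, i) (j, j)).re := by
  have h := real_re M hM (fun r => if r.1 = r.2 then 1 else 0)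
  simp [dotProduct, Matrix.mulVec, Fintype.sum_prod_type, Fin.sum_univ_three] at h
  simp [Fin.sum_univ_three]
  linarith

lemma key (a b c : ℝ) (habc : a = 2 - b - c)
    (P Q : Matrix (Fin 3 × Fin 3) (Fin 3 × Fin 3) ℂ)
    (hP : P.PosSemidef) (hQ : Q.PosSemidef) (h : Wmat a b c = P + ptrans Q)
    (t : ℝ) (ht : 0 < t) : 0 ≤ (t - 1) * (b * t - c) := by
  have hs : a + b + c = 2 := by linarith
  have E : ∀ p q, (Wmat a b c p q).re = (P p q).re + (Q (p.1, q.2) (q.1, p.2)).re := by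
    intro p q; rw [h]; simp [ptrans]
  have h3 := psd_three P hP
  simp only [Fin.sum_univ_three] at h3
  have d := psd_diag P hP
  have d' := psd_diag Q hQ
  have q1 := psd_two Q hQ (0, 1) (1, 0) t
  have q2 := psd_two Q hQ (1, 2) (2, 1) t
  have q3 := psd_two Q hQ (2, 0) (0, 2) t
  have e00 := E (0,0) (0,0)
  have e11 := E (1,1) (1,1)
  have e22 := E (2,2) (2,2)
  have e01 := E (0,0) (1,1)
  have e02 := E (0,0) (2,2)
  have e10 := E (1,1) (0,0)
  have e12 := E (1,1) (2,2)
  have e20 := E (2,2) (0,0)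
  have e21 := E (2,2) (1,1)
  have f01 := E (0,1) (0,1)
  have f12 := E (1,2) (1,2)
  have f20 := E (2,0) (2,0)
  have g02 := E (0,2) (0,2)
  have g10 := E (1,0) (1,0)
  have g21 := E (2,1) (2,1)
  simp [Wmat, hs, -Complex.ofReal_div] at e00 e11 e22 e01 e02 e10 e12 e20 e21 f01 f12 f20 g02 g10 g21
  have w := mul_nonneg ht.le h3
  have w0 := fun p => mul_nonneg (sq_nonneg t) (d p)
  have w1 := fun p => mul_nonneg ht.le (d' p)
  subst habc
  linear_combination 2 * (w + w0 (0,1) + w0 (1,2) + w0 (2,0) + d (0,2) + d (1,0) + d (2,1) + w1 (0,0) + w1 (1,1) + w1 (2,2)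
    + q1 + q2 + q3)
    - 2 * t * (e00 + e11 + e22 + e01 + e02 + e10 + e12 + e20 + e21)
    - 2 * t ^ 2 * (f01 + f12 + f20) - 2 * (g02 + g10 + g21)

set_option maxHeartbeats 4000000 in
/-- for `b, c ≥ 0` and `a = 2 − b − c ≥ 0` with `bc ≥ (1−a)²`
whenever `a ≤ 1`, the witness `W[a,b,c]` is decomposable iff `b = c`, which is
precisely the condition that `Φ[a,b,c]` is self-dual (equals `Φ[a,c,b]`). -/
theorem stmt4 (a b c : ℝ) (hb : 0 ≤ b) (hc : 0 ≤ c) (habc : a = 2 - b - c)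
    (ha : 0 ≤ a) (hell : a ≤ 1 → (1 - a) ^ 2 ≤ b * c) :
    ((∃ P Q : Matrix (Fin 3 × Fin 3) (Fin 3 × Fin 3) ℂ,
        P.PosSemidef ∧ Q.PosSemidef ∧ Wmat a b c = P + ptrans Q) ↔ b = c) ∧
      (b = c ↔ Phi a b c = Phi a c b) := by
  have hs : a + b + c = 2 := by linarith
  have hs' : a + c + b = 2 := by linarith
  refine ⟨⟨?_, ?_⟩, ⟨?_, ?_⟩⟩
  · rintro ⟨P, Q, hP, hQ, h⟩
    have k := key a b c habc P Q hP hQ h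
    by_contra hne
    rcases lt_or_gt_of_ne hne with hlt | hlt
    · have hc0 : 0 < c := lt_of_le_of_lt hb hlt
      have := k ((b + 3 * c) / (2 * (b + c))) (by positivity)
      have hbc : 0 < b + c := by linarith
      have e : ((b + 3 * c) / (2 * (b + c)) - 1) * (b * ((b + 3 * c) / (2 * (b + c))) - c)
          = -((c - b) ^ 2 * (b + 2 * c)) / (2 * (b + c)) ^ 2 := by
        field_simp; ring
      rw [e] at this
      have : 0 < (c - b) ^ 2 * (b + 2 * c) / (2 * (b + c)) ^ 2 := by
        have : 0 < c - b := by linarith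
        positivity
      rw [neg_div] at *
      linarith
    · have hb0 : 0 < b := lt_of_le_of_lt hc hlt
      have := k ((b + c) / (2 * b)) (by positivity)
      have e : ((b + c) / (2 * b) - 1) * (b * ((b + c) / (2 * b)) - c)
          = -((b - c) ^ 2 / (4 * b)) := by
        field_simp; ring
      rw [e] at this
      have : 0 < (b - c) ^ 2 / (4 * b) := by
        have : 0 < b - c := by linarith
        positivity
      linarith
  · rintro rfl
    have h1 : (0 : ℂ) ≤ (((1 - b) / 6 : ℝ) : ℂ) := by
      rw [Complex.zero_le_real]; linarith
    have h2 : (0 : ℂ) ≤ ((b / 6 : ℝ) : ℂ) := by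
      rw [Complex.zero_le_real]; linarith
    refine ⟨(((1 - b) / 6 : ℝ) : ℂ) • (rk (0,0) (1,1) + rk (1,1) (2,2) + rk (2,2) (0,0)),
      ((b / 6 : ℝ) : ℂ) • (rk (0,1) (1,0) + rk (1,2) (2,1) + rk (2,0) (0,2)),
      (((rk_psd _ _).add (rk_psd _ _)).add (rk_psd _ _)).smul h1,
      (((rk_psd _ _).add (rk_psd _ _)).add (rk_psd _ _)).smul h2, ?_⟩
    ext ⟨i, j⟩ ⟨k, l⟩
    subst habc
    fin_cases i <;> fin_cases j <;> fin_cases k <;> fin_cases l <;>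
      simp [Wmat, ptrans, rk, vv, Matrix.vecMulVec_apply, hs] <;> ring
  · rintro rfl; rfl
  · intro h
    have h := congrFun (congrFun (congrFun h (Matrix.single 1 1 1)) 0) 0
    simp [Phi, hs, hs', Matrix.single] at h
    exact h
end

section
/- For every ε > 0, the matrix ρ_ε is positive semidefinite and its partial transposition ρ_ε^Γ is positive semidefinite; that is, ρ_ε is a PPT matrix for all ε > 0. -/
open scoped ComplexOrder

/-- The (unnormalized) state
`ρ_ε = Σ_{i,j} |ii⟩⟨jj| + ε Σ_i |i,i+1⟩⟨i,i+1| + ε⁻¹ Σ_i |i,i+2⟩⟨i,i+2|`. -/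
noncomputable def rho (ε : ℝ) : Matrix (Fin 3 × Fin 3) (Fin 3 × Fin 3) ℂ :=
  Matrix.of fun p q =>
    (if p.1 = p.2 ∧ q.1 = q.2 then 1 else 0) +
      (if p = q ∧ p.2 = p.1 + 1 then (ε : ℂ) else 0) +
      (if p = q ∧ p.2 = p.1 + 2 then ((ε⁻¹ : ℝ) : ℂ) else 0)

/-- for every `ε > 0`, the matrix `ρ_ε` is positive semidefinite
and so is its partial transpose: `ρ_ε` is PPT. -/
theorem stmt6 (ε : ℝ) (hε : 0 < ε) :
    (rho ε).PosSemidef ∧ (ptrans (rho ε)).PosSemidef := by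
  have hε0 : (ε : ℂ) ≠ 0 := by exact_mod_cast hε.ne'
  have hi : (0 : ℂ) ≤ ((ε⁻¹ : ℝ) : ℂ) := by exact_mod_cast (inv_pos.mpr hε).le
  have he : (0 : ℂ) ≤ (ε : ℂ) := by exact_mod_cast hε.le
  constructor
  · have h : rho ε = Matrix.vecMulVec (fun p : Fin 3 × Fin 3 => if p.1 = p.2 then (1 : ℂ) else 0)
          (star (fun p : Fin 3 × Fin 3 => if p.1 = p.2 then (1 : ℂ) else 0)) +
        Matrix.diagonal (fun p : Fin 3 × Fin 3 => (if p.2 = p.1 + 1 then (ε : ℂ) else 0) +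
          (if p.2 = p.1 + 2 then ((ε⁻¹ : ℝ) : ℂ) else 0)) := by
      ext p q
      simp only [rho, Matrix.of_apply, Matrix.add_apply, Matrix.vecMulVec_apply, Pi.star_apply,
        Matrix.diagonal_apply]
      by_cases h1 : p.1 = p.2 <;> by_cases h2 : q.1 = q.2 <;> by_cases h3 : p = q <;>
        simp [h1, h2, h3]
    rw [h]
    refine (Matrix.posSemidef_vecMulVec_self_star _).add (Matrix.PosSemidef.diagonal ?_)
    intro p
    refine add_nonneg ?_ ?_ <;> split_ifs <;> first | assumption | exact le_rfl
  · have h : ptrans (rho ε) =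
        Matrix.diagonal (fun p : Fin 3 × Fin 3 => if p.1 = p.2 then (1 : ℂ) else 0) +
        ∑ i : Fin 3, ((ε⁻¹ : ℝ) : ℂ) • Matrix.vecMulVec
          (fun p : Fin 3 × Fin 3 => (if p = (i, i + 1) then (ε : ℂ) else 0) +
            (if p = (i + 1, i) then 1 else 0))
          (star (fun p : Fin 3 × Fin 3 => (if p = (i, i + 1) then (ε : ℂ) else 0) +
            (if p = (i + 1, i) then 1 else 0))) := by
      ext ⟨a, b⟩ ⟨c, d⟩
      simp only [ptrans, rho, Matrix.of_apply, Matrix.add_apply, Matrix.vecMulVec_apply,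
        Pi.star_apply, Matrix.diagonal_apply, Fin.sum_univ_three, Matrix.smul_apply, smul_eq_mul,
        Prod.mk.injEq]
      fin_cases a <;> fin_cases b <;> fin_cases c <;> fin_cases d <;>
        simp [Fin.ext_iff, Fin.val_add, hε0]
    rw [h]
    refine (Matrix.PosSemidef.diagonal ?_).add (Matrix.posSemidef_sum _ fun i _ =>
      (Matrix.posSemidef_vecMulVec_self_star _).smul hi)
    intro p
    dsimp only
    split_ifs <;> simp
end

section
/- For every ε > 0 with ε ≠ 1, the matrix ρ_ε is entangled, i.e. ρ_ε is not separable. -/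
open scoped ComplexOrder

/-- A `9 × 9` matrix on `ℂ³ ⊗ ℂ³` is separable if it is a finite sum of
Kronecker products `(x x*) ⊗ (y y*)` with `x, y ∈ ℂ³`. -/
def Separable (σ : Matrix (Fin 3 × Fin 3) (Fin 3 × Fin 3) ℂ) : Prop :=
  ∃ (m : ℕ) (x y : Fin m → Fin 3 → ℂ),
    σ = ∑ k, Matrix.kroneckerMap (· * ·)
      (Matrix.vecMulVec (x k) (star (x k)))
      (Matrix.vecMulVec (y k) (star (y k)))

lemma aux_zero {m : ℕ} (z : Fin m → ℂ) (h : ∑ k, z k * star (z k) = 0) (k : Fin m) : z k = 0 := by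
  have h2 := (Finset.sum_eq_zero_iff_of_nonneg (fun i _ => mul_star_self_nonneg (z i))).1 h k
    (Finset.mem_univ k)
  simpa using h2

/-- for every `ε > 0` with `ε ≠ 1`, the matrix `ρ_ε` is
entangled, i.e. not separable. -/
theorem stmt7 (ε : ℝ) (hε : 0 < ε) (hne : ε ≠ 1) : ¬ Separable (rho ε) := by
  rintro ⟨m, x, y, h⟩
  have hc : (ε : ℂ) ≠ 0 := by exact_mod_cast hε.ne'
  have e : ∀ a b c d : Fin 3, ∑ k, x k a * star (x k c) * (y k b * star (y k d))
      = rho ε (a, b) (c, d) := by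
    intro a b c d
    rw [h, Matrix.sum_apply]
    simp [Matrix.vecMulVec_apply]
  have h1 : ∀ i k, x k i * y k i - x k (i+1) * y k (i+1) = 0 := by
    intro i
    apply aux_zero
    have : ∑ k, (x k i * y k i - x k (i+1) * y k (i+1)) *
        star (x k i * y k i - x k (i+1) * y k (i+1)) =
        rho ε (i,i) (i,i) - rho ε (i,i) (i+1,i+1) - rho ε (i+1,i+1) (i,i)
        + rho ε (i+1,i+1) (i+1,i+1) := by
      simp only [← e, ← Finset.sum_sub_distrib, ← Finset.sum_add_distrib]
      refine Finset.sum_congr rfl fun k _ => ?_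
      simp only [star_sub, star_mul]
      ring
    rw [this]
    fin_cases i <;> simp [rho]
  have h2 : ∀ i k, x k i * star (y k (i+1)) - ε * (x k (i+1) * star (y k i)) = 0 := by
    intro i
    apply aux_zero
    have : ∑ k, (x k i * star (y k (i+1)) - ε * (x k (i+1) * star (y k i))) *
        star (x k i * star (y k (i+1)) - ε * (x k (i+1) * star (y k i))) =
        rho ε (i,i+1) (i,i+1) - ε * rho ε (i,i) (i+1,i+1) - ε * rho ε (i+1,i+1) (i,i)
        + ε * ε * rho ε (i+1,i) (i+1,i) := by
      simp only [← e, Finset.mul_sum, ← Finset.sum_sub_distrib, ← Finset.sum_add_distrib]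
      refine Finset.sum_congr rfl fun k _ => ?_
      have : star (ε : ℂ) = ε := Complex.conj_ofReal ε
      simp only [star_sub, star_mul, star_star, this]
      ring
    rw [this]
    fin_cases i <;> simp [rho] <;> field_simp <;> ring
  obtain ⟨k, hk⟩ : ∃ k, x k 0 * y k 0 ≠ 0 := by
    by_contra! hcon
    have h0 := e 0 0 0 0
    rw [Finset.sum_eq_zero] at h0
    · simp [rho] at h0
    · intro k _
      linear_combination (star (x k 0) * star (y k 0)) * hcon k
  have a0 := h1 0 k
  have a1 := h1 1 k
  have b0 := h2 0 k
  have b1 := h2 1 k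
  have b2 := h2 2 k
  simp only [show (0:Fin 3)+1 = 1 from rfl, show (1:Fin 3)+1 = 2 from rfl,
    show (2:Fin 3)+1 = 0 from rfl, sub_eq_zero] at a0 a1 b0 b1 b2
  have k1 : x k 1 * y k 1 ≠ 0 := a0 ▸ hk
  have k2 : x k 2 * y k 2 ≠ 0 := a1 ▸ k1
  simp only [mul_ne_zero_iff] at hk k1 k2
  have hP : x k 0 * x k 1 * x k 2 * (star (y k 0) * star (y k 1) * star (y k 2)) ≠ 0 := by
    simp [hk, k1, k2]
  have hQ : (ε:ℂ)^3 = 1 := by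
    apply mul_right_cancel₀ hP
    have := congrArg₂ (· * ·) (congrArg₂ (· * ·) b0 b1) b2
    linear_combination -this
  have hR : ε^3 = 1 := by exact_mod_cast hQ
  exact hne ((pow_eq_one_iff_of_nonneg hε.le (by norm_num)).1 hR)
end

section
/- Let n ≥ 2 and let f₁, …, f_{n²−1} be traceless Hermitian n×n complex matrices that are orthonormal with respect to the Hilbert–Schmidt inner product, i.e. Tr(f_k f_l) = δ_{kl}. Let R be a real orthogonal (n²−1)×(n²−1) matrix. Then the linear map Φ_R on M_n(ℂ) defined by Φ_R(X) = (1/n)·Tr(X)·I_n + (1/(n−1))·Σ_{k,l=1}^{n²−1} R_{kl}·Tr(f_l X)·f_k is a positive map: it sends every positive semidefinite matrix to a positive semidefinite matrix. -/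
open scoped ComplexOrder

lemma aux_real {n : ℕ} (A B : Matrix (Fin n) (Fin n) ℂ) (hA : A.IsHermitian) (hB : B.IsHermitian) :
    (A * B).trace = (((A * B).trace.re : ℝ) : ℂ) := by
  have h : star (A * B).trace = (A * B).trace := by
    rw [← Matrix.trace_conjTranspose, Matrix.conjTranspose_mul, hA.eq, hB.eq, Matrix.trace_mul_comm]
  exact (Complex.conj_eq_iff_re.mp h).symm

lemma aux_sq {n : ℕ} (X : Matrix (Fin n) (Fin n) ℂ) (hX : X.PosSemidef) :
    (X * X).trace.re ≤ X.trace.re ^ 2 := by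
  have h1 : (X * X).trace = ∑ i, ((hX.1.eigenvalues i : ℝ) : ℂ) ^ 2 := by
    have h := hX.1.spectral_theorem
    rw [Unitary.conjStarAlgAut_apply] at h
    set U := hX.1.eigenvectorUnitary
    have hU : star (U : Matrix (Fin n) (Fin n) ℂ) * (U : Matrix (Fin n) (Fin n) ℂ) = 1 :=
      Unitary.coe_star_mul_self U
    set D := Matrix.diagonal ((RCLike.ofReal : ℝ → ℂ) ∘ hX.1.eigenvalues) with hD
    have : X * X = U * (D * D * star (U : Matrix (Fin n) (Fin n) ℂ)) := by
      calc X * X = (U * D * star (U : Matrix (Fin n) (Fin n) ℂ)) *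
            (U * D * star (U : Matrix (Fin n) (Fin n) ℂ)) := by rw [← h]
        _ = U * D * (star (U : Matrix (Fin n) (Fin n) ℂ) * U) * (D * star (U : Matrix (Fin n) (Fin n) ℂ)) := by
            simp only [Matrix.mul_assoc]
        _ = _ := by rw [hU]; simp only [Matrix.mul_assoc, Matrix.mul_one]
    rw [this, Matrix.trace_mul_comm, Matrix.mul_assoc, hU, Matrix.mul_one, hD,
      Matrix.diagonal_mul_diagonal, Matrix.trace_diagonal]
    simp [sq]
  have h2 : X.trace = ∑ i, ((hX.1.eigenvalues i : ℝ) : ℂ) := hX.1.trace_eq_sum_eigenvalues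
  have h1' : (X * X).trace.re = ∑ i, (hX.1.eigenvalues i) ^ 2 := by
    rw [h1]; norm_cast
  have h2' : X.trace.re = ∑ i, hX.1.eigenvalues i := by
    rw [h2]; norm_cast
  rw [h1', h2']
  exact Finset.sum_sq_le_sq_sum_of_nonneg (fun i _ => hX.eigenvalues_nonneg i)

lemma aux_bessel {n m : ℕ} (hn : 2 ≤ n) (f : Fin m → Matrix (Fin n) (Fin n) ℂ)
    (hherm : ∀ k, (f k).IsHermitian)
    (htr : ∀ k, (f k).trace = 0)
    (horth : ∀ k l, (f k * f l).trace = if k = l then 1 else 0)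
    (X : Matrix (Fin n) (Fin n) ℂ) (hX : X.PosSemidef) :
    ∑ l, (f l * X).trace.re ^ 2 ≤ (1 - (n : ℝ)⁻¹) * X.trace.re ^ 2 := by
  have hn0 : (n : ℂ) ≠ 0 := by norm_cast; omega
  obtain ⟨t, ht⟩ : ∃ t : ℝ, X.trace = t := by
    have := aux_real 1 X Matrix.isHermitian_one hX.1
    exact ⟨_, by simpa using this⟩
  obtain ⟨x, hx⟩ : ∃ x : Fin m → ℝ, ∀ l, (f l * X).trace = x l :=
    ⟨_, fun l => aux_real (f l) X (hherm l) hX.1⟩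
  set Z : Matrix (Fin n) (Fin n) ℂ := ((t : ℂ) / n) • 1 + ∑ l, (x l : ℂ) • f l with hZ
  have hZH : Z.IsHermitian := by
    unfold Matrix.IsHermitian
    rw [hZ, Matrix.conjTranspose_add, Matrix.conjTranspose_sum]
    simp [Matrix.conjTranspose_smul, (hherm _).eq]
  have hZW : ∀ W, (Z * W).trace = (t : ℂ) / n * W.trace + ∑ l, (x l : ℂ) * (f l * W).trace := by
    intro W
    simp [hZ, add_mul, Finset.sum_mul, Matrix.trace_add, Matrix.trace_sum, Matrix.trace_smul]
  have hZt : Z.trace = t := by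
    simp [hZ, Matrix.trace_add, Matrix.trace_sum, Matrix.trace_smul, htr, hn0]
  have hfZ : ∀ k, (f k * Z).trace = x k := by
    intro k
    rw [Matrix.trace_mul_comm, hZW, htr]
    simp [horth]
  have hZX := hZW X
  have hZZ := hZW Z
  simp only [hx, ht] at hZX
  simp only [hfZ, hZt] at hZZ
  have hY : 0 ≤ ((X - Z).conjTranspose * (X - Z)).trace :=
    (Matrix.posSemidef_conjTranspose_mul_self (X - Z)).trace_nonneg
  rw [(hX.1.sub hZH).eq, sub_mul, mul_sub, mul_sub, Matrix.trace_sub, Matrix.trace_sub,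
    Matrix.trace_sub, Matrix.trace_mul_comm X Z, hZX, hZZ] at hY
  have hY' := (Complex.le_def.mp hY).1
  have hs := aux_sq X hX
  have e : ((t : ℂ) / n * t + ∑ l, (x l : ℂ) * x l) = ((t / n * t + ∑ l, x l * x l : ℝ) : ℂ) := by
    push_cast; rfl
  rw [e] at hY'
  simp only [Complex.zero_re, Complex.sub_re, Complex.ofReal_re, sub_self, sub_zero] at hY'
  simp only [hx, ht, Complex.ofReal_re] at hs ⊢
  have e2 : ∑ l, x l ^ 2 = ∑ l, x l * x l := by simp [sq]
  rw [e2]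
  have e3 : (1 - (n : ℝ)⁻¹) * t ^ 2 = t ^ 2 - t / n * t := by ring
  rw [e3]
  linarith

theorem stmt9 (n : ℕ) (hn : 2 ≤ n)
    (f : Fin (n ^ 2 - 1) → Matrix (Fin n) (Fin n) ℂ)
    (hherm : ∀ k, (f k).IsHermitian)
    (htr : ∀ k, (f k).trace = 0)
    (horth : ∀ k l, (f k * f l).trace = if k = l then 1 else 0)
    (R : Matrix (Fin (n ^ 2 - 1)) (Fin (n ^ 2 - 1)) ℝ)
    (hR : R * R.transpose = 1)
    (X : Matrix (Fin n) (Fin n) ℂ) (hX : X.PosSemidef) :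
    (((n : ℂ)⁻¹ * X.trace) • (1 : Matrix (Fin n) (Fin n) ℂ) +
        ((((n : ℝ) - 1)⁻¹ : ℝ) : ℂ) •
          ∑ k, ∑ l, ((R k l : ℝ) : ℂ) • ((f l * X).trace • f k)).PosSemidef := by
  have hb := aux_bessel hn f hherm htr horth X hX
  have ht0 : 0 ≤ X.trace.re := (Complex.le_def.mp hX.trace_nonneg).1
  obtain ⟨t, ht⟩ : ∃ t : ℝ, X.trace = t := by
    have := aux_real 1 X Matrix.isHermitian_one hX.1
    exact ⟨_, by simpa using this⟩
  obtain ⟨x, hx⟩ : ∃ x : Fin (n ^ 2 - 1) → ℝ, ∀ l, (f l * X).trace = x l :=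
    ⟨_, fun l => aux_real (f l) X (hherm l) hX.1⟩
  simp only [hx, ht, Complex.ofReal_re] at hb ht0 ⊢
  refine Matrix.PosSemidef.of_dotProduct_mulVec_nonneg ?_ ?_
  · unfold Matrix.IsHermitian
    simp only [Matrix.conjTranspose_add, Matrix.conjTranspose_sum, Matrix.conjTranspose_smul,
      (hherm _).eq]
    simp
  · intro v
    have hP : (Matrix.vecMulVec v (star v)).PosSemidef := Matrix.posSemidef_vecMulVec_self_star v
    have hq : ∀ A : Matrix (Fin n) (Fin n) ℂ,
        star v ⬝ᵥ A.mulVec v = (A * Matrix.vecMulVec v (star v)).trace := by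
      intro A
      rw [Matrix.mul_vecMulVec, Matrix.trace_vecMulVec, dotProduct_comm]
    rw [hq]
    set P := Matrix.vecMulVec v (star v)
    have hc := aux_bessel hn f hherm htr horth P hP
    have hs0 : 0 ≤ P.trace.re := (Complex.le_def.mp hP.trace_nonneg).1
    obtain ⟨s, hs⟩ : ∃ t : ℝ, P.trace = t := by
      have := aux_real 1 P Matrix.isHermitian_one hP.1
      exact ⟨_, by simpa using this⟩
    obtain ⟨y, hy⟩ : ∃ x : Fin (n ^ 2 - 1) → ℝ, ∀ l, (f l * P).trace = x l :=
      ⟨_, fun l => aux_real (f l) P (hherm l) hP.1⟩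
    simp only [hy, hs, Complex.ofReal_re] at hc hs0
    simp only [add_mul, Finset.sum_mul, Matrix.trace_add, Matrix.trace_sum, Matrix.trace_smul,
      Matrix.smul_mul, hy, hs, Matrix.one_mul, smul_eq_mul]
    have e : ((n : ℂ)⁻¹ * t * s + ((((n : ℝ) - 1)⁻¹ : ℝ) : ℂ) *
        ∑ k, ∑ l, (R k l : ℂ) * ((x l : ℂ) * y k)) =
        (((n : ℝ)⁻¹ * t * s + ((n : ℝ) - 1)⁻¹ * ∑ k, y k * (R.mulVec x) k : ℝ) : ℂ) := by
      push_cast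
      congr 2
      refine Finset.sum_congr rfl fun k _ => ?_
      simp only [Matrix.mulVec, dotProduct]
      push_cast
      rw [Finset.mul_sum]
      exact Finset.sum_congr rfl fun l _ => by ring
    rw [e]
    rw [Complex.zero_le_real]
    have hRx : ∑ k, (R.mulVec x k) ^ 2 = ∑ l, x l ^ 2 := by
      have h1 : R.transpose * R = 1 := mul_eq_one_comm.mp hR
      have h2 : R.mulVec x ⬝ᵥ R.mulVec x = x ⬝ᵥ x := by
        rw [Matrix.dotProduct_mulVec, Matrix.vecMul_mulVec, h1, Matrix.vecMul_one]
      simpa [dotProduct, sq] using h2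
    have hcs := Finset.sum_mul_sq_le_sq_mul_sq Finset.univ y (R.mulVec x)
    rw [hRx] at hcs
    set S := ∑ k, y k * R.mulVec x k
    have hn2 : (2 : ℝ) ≤ n := by exact_mod_cast hn
    have hc0 : 0 ≤ 1 - (n : ℝ)⁻¹ := by
      have : (n : ℝ)⁻¹ ≤ 1 := inv_le_one_of_one_le₀ (by linarith)
      linarith
    have hS : S ^ 2 ≤ ((1 - (n : ℝ)⁻¹) * t * s) ^ 2 := by
      calc S ^ 2 ≤ _ := hcs
        _ ≤ ((1 - (n : ℝ)⁻¹) * s ^ 2) * ((1 - (n : ℝ)⁻¹) * t ^ 2) :=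
          mul_le_mul hc hb (Finset.sum_nonneg fun _ _ => sq_nonneg _) (by positivity)
        _ = _ := by ring
    have hS' := (abs_le_of_sq_le_sq' hS (by positivity)).1
    have hn1 : (0 : ℝ) < n - 1 := by linarith
    have hfin : ((n : ℝ) - 1)⁻¹ * (-((1 - (n : ℝ)⁻¹) * t * s)) = - ((n : ℝ)⁻¹ * t * s) := by
      field_simp
    have := mul_le_mul_of_nonneg_left hS' (inv_nonneg.mpr hn1.le)
    linarith
end

section
/- Let a, b, c be real numbers with a, b, c ≥ 0 and a + b + c = 2, and let p ∈ [0,1]. Then the 9×9 matrix W(p) = (1 − p)·W[a,b,c] + (p/9)·I₉ is positive semidefinite if and only if p ≥ p*, where p* = 3(2 − a)/(2 + 3(2 − a)). In particular p* is the smallest value of p for which the structural physical approximation W(p) is a quantum state. -/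
open scoped ComplexOrder

/-- The difference of two diagonal basis vectors. -/
def dvec (i j : Fin 3) : Fin 3 × Fin 3 → ℂ :=
  fun q => (if q = (i, i) then 1 else 0) - (if q = (j, j) then 1 else 0)

/-- The diagonal part of the decomposition. -/
noncomputable def ddiag (a b c p : ℝ) : Fin 3 × Fin 3 → ℝ :=
  fun q => if q.2 = q.1 then (1 - p) / 6 * (a - 2) + p / 9
    else if q.2 = q.1 + 1 then (1 - p) / 6 * b + p / 9 else (1 - p) / 6 * c + p / 9

set_option maxHeartbeats 4000000 in
theorem decomp (a b c p : ℝ) (hsum : a + b + c = 2) :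
    (((1 - p : ℝ) : ℂ) • Wmat a b c +
        ((p / 9 : ℝ) : ℂ) • (1 : Matrix (Fin 3 × Fin 3) (Fin 3 × Fin 3) ℂ)) =
    Matrix.diagonal (fun q => ((ddiag a b c p q : ℝ) : ℂ)) +
      (((1 - p) / 6 : ℝ) : ℂ) • (Matrix.vecMulVec (dvec 0 1) (star (dvec 0 1)) +
        Matrix.vecMulVec (dvec 1 2) (star (dvec 1 2)) +
        Matrix.vecMulVec (dvec 0 2) (star (dvec 0 2))) := by
  ext ⟨i, j⟩ ⟨k, l⟩
  simp only [Wmat, hsum]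
  fin_cases i <;> fin_cases j <;> fin_cases k <;> fin_cases l <;>
    simp [ddiag, dvec, Matrix.vecMulVec_apply, Matrix.diagonal_apply, Matrix.one_apply] <;>
    ring

/-- for `a, b, c ≥ 0` with `a + b + c = 2` and `p ∈ [0,1]`, the
structural physical approximation `W(p) = (1−p)·W[a,b,c] + (p/9)·I₉` is
positive semidefinite iff `p ≥ p* = 3(2−a)/(2 + 3(2−a))`. -/
theorem stmt12 (a b c : ℝ) (ha : 0 ≤ a) (hb : 0 ≤ b) (hc : 0 ≤ c)
    (hsum : a + b + c = 2) (p : ℝ) (hp : p ∈ Set.Icc (0 : ℝ) 1) :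
    (((1 - p : ℝ) : ℂ) • Wmat a b c +
        ((p / 9 : ℝ) : ℂ) • (1 : Matrix (Fin 3 × Fin 3) (Fin 3 × Fin 3) ℂ)).PosSemidef ↔
      3 * (2 - a) / (2 + 3 * (2 - a)) ≤ p := by
  have h0 := hp.1
  have h1 := hp.2
  have hpos : 0 < 2 + 3 * (2 - a) := by linarith
  rw [div_le_iff₀ hpos]
  constructor
  · intro h
    have h2 := h.dotProduct_mulVec_nonneg (fun q => if q.2 = q.1 then 1 else 0)
    simp [Wmat, hsum, dotProduct, Matrix.mulVec, Fintype.sum_prod_type, Fin.sum_univ_three,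
      Matrix.one_apply] at h2
    have h3 := (Complex.le_def.1 h2).1
    norm_num at h3
    simp at h3
    nlinarith
  · intro h
    rw [decomp a b c p hsum]
    refine Matrix.PosSemidef.add ?_ (Matrix.PosSemidef.smul ?_ ?_)
    · refine Matrix.PosSemidef.diagonal fun q => ?_
      have : 0 ≤ ddiag a b c p q := by
        have hb' := mul_nonneg (sub_nonneg.2 h1) hb
        have hc' := mul_nonneg (sub_nonneg.2 h1) hc
        unfold ddiag
        split_ifs <;> nlinarith
      exact Complex.zero_le_real.2 this
    · exact ((Matrix.posSemidef_vecMulVec_self_star _).add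
        (Matrix.posSemidef_vecMulVec_self_star _)).add (Matrix.posSemidef_vecMulVec_self_star _)
    · have : 0 ≤ (1 - p) / 6 := by linarith
      exact_mod_cast this
end

section
/- Let a, b, c be real numbers with a, b, c ≥ 0, a + b + c = 2, 2b + c ≥ 1, and 2c + b ≥ 1. Then the structural physical approximation W(p*) = (1 − p*)·W[a,b,c] + (p*/9)·I₉ with p* = 3(2 − a)/(2 + 3(2 − a)) is a separable positive semidefinite matrix. -/
open scoped ComplexOrder

/-- A product term. -/
noncomputable def PT (x y : Fin 3 → ℂ) : Matrix (Fin 3 × Fin 3) (Fin 3 × Fin 3) ℂ :=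
  Matrix.kroneckerMap (· * ·) (Matrix.vecMulVec x (star x)) (Matrix.vecMulVec y (star y))

lemma sep_PT (x y : Fin 3 → ℂ) : Separable (PT x y) :=
  ⟨1, fun _ => x, fun _ => y, by simp [PT]⟩

lemma sep_zero : Separable 0 := ⟨0, fun _ => 0, fun _ => 0, by simp⟩

lemma sep_add {A B : Matrix (Fin 3 × Fin 3) (Fin 3 × Fin 3) ℂ}
    (hA : Separable A) (hB : Separable B) : Separable (A + B) := by
  obtain ⟨m, x, y, rfl⟩ := hA
  obtain ⟨n, z, w, rfl⟩ := hB
  refine ⟨m + n, Fin.append x z, Fin.append y w, ?_⟩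
  rw [Fin.sum_univ_add]
  simp

lemma sep_sum {ι : Type} (s : Finset ι) (f : ι → Matrix (Fin 3 × Fin 3) (Fin 3 × Fin 3) ℂ)
    (h : ∀ i, Separable (f i)) : Separable (∑ i ∈ s, f i) := by
  classical
  induction s using Finset.induction_on with
  | empty => simpa using sep_zero
  | insert i s hi ih => rw [Finset.sum_insert hi]; exact sep_add (h i) ih

lemma sep_smul {A : Matrix (Fin 3 × Fin 3) (Fin 3 × Fin 3) ℂ} (r : ℝ) (hr : 0 ≤ r)
    (hA : Separable A) : Separable ((r : ℂ) • A) := by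
  obtain ⟨m, x, y, rfl⟩ := hA
  refine ⟨m, fun k => ((Real.sqrt r : ℝ) : ℂ) • x k, y, ?_⟩
  have h : ((Real.sqrt r : ℝ) : ℂ) * ((Real.sqrt r : ℝ) : ℂ) = (r : ℂ) := by
    rw [← Complex.ofReal_mul, Real.mul_self_sqrt hr]
  rw [Finset.smul_sum]
  refine Finset.sum_congr rfl fun k _ => ?_
  ext p q
  simp only [Matrix.smul_apply, Matrix.kroneckerMap_apply, Matrix.vecMulVec_apply, Pi.star_apply,
    Pi.smul_apply, smul_eq_mul, star_mul', Complex.star_def, Complex.conj_ofReal, ← h]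
  ring

lemma sep_psd {A : Matrix (Fin 3 × Fin 3) (Fin 3 × Fin 3) ℂ}
    (hA : Separable A) : A.PosSemidef := by
  obtain ⟨m, x, y, rfl⟩ := hA
  refine Matrix.posSemidef_sum _ fun k _ => ?_
  exact (Matrix.posSemidef_vecMulVec_self_star (x k)).kronecker
    (Matrix.posSemidef_vecMulVec_self_star (y k))

/-- Averaged product terms on the qubit pair `(i, i+1)`. -/
noncomputable def Q (i : Fin 3) (w : ℂ) : Matrix (Fin 3 × Fin 3) (Fin 3 × Fin 3) ℂ :=
  PT (fun j => if j = i then 1 else if j = i + 1 then w else 0)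
    (fun j => if j = i then 1 else if j = i + 1 then -star w else 0)

/-- The unit product term. -/
noncomputable def E (i j : Fin 3) : Matrix (Fin 3 × Fin 3) (Fin 3 × Fin 3) ℂ :=
  PT (Pi.single i 1) (Pi.single j 1)

lemma E_eq (i j : Fin 3) : E i j = Matrix.of fun p q =>
    if p = (i, j) ∧ q = (i, j) then 1 else 0 := by
  ext ⟨p, p'⟩ ⟨q, q'⟩
  simp only [E, PT, Matrix.kroneckerMap_apply, Matrix.vecMulVec_apply, Pi.star_apply,
    Pi.single_apply, Matrix.of_apply, Prod.mk.injEq]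
  by_cases h1 : p = i <;> by_cases h2 : p' = j <;> by_cases h3 : q = i <;>
    by_cases h4 : q' = j <;> simp [h1, h2, h3, h4]

lemma Q_sum (i : Fin 3) : ((1/4 : ℝ) : ℂ) • (Q i 1 + Q i Complex.I + Q i (-1) + Q i (-Complex.I))
    = Matrix.of fun p q => if p = q then
        (if (p.1 = i ∨ p.1 = i + 1) ∧ (p.2 = i ∨ p.2 = i + 1) then 1 else 0)
      else if (p = (i, i) ∧ q = (i+1, i+1)) ∨ (q = (i, i) ∧ p = (i+1, i+1)) then -1 else 0 := by
  ext ⟨p, p'⟩ ⟨q, q'⟩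
  simp only [Q, PT, Matrix.smul_apply, Matrix.add_apply, Matrix.kroneckerMap_apply,
    Matrix.vecMulVec_apply, Pi.star_apply, Matrix.of_apply, Prod.mk.injEq]
  have hi : i + 1 ≠ i := by fin_cases i <;> decide
  by_cases h1 : p = i <;> by_cases h1' : p = i + 1 <;>
  by_cases h2 : p' = i <;> by_cases h2' : p' = i + 1 <;>
  by_cases h3 : q = i <;> by_cases h3' : q = i + 1 <;>
  by_cases h4 : q' = i <;> by_cases h4' : q' = i + 1 <;>
  first
    | (exfalso; omega)
    | (simp [*, hi.symm] <;> (try ring_nf) <;> (try simp) <;> (try norm_num) <;> grind)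

lemma decomp_s13 (a b c : ℝ) (ha : a ≤ 2) (hsum : a + b + c = 2) :
    (((1 - 3 * (2 - a) / (2 + 3 * (2 - a)) : ℝ) : ℂ) • Wmat a b c +
        ((3 * (2 - a) / (2 + 3 * (2 - a)) / 9 : ℝ) : ℂ) •
          (1 : Matrix (Fin 3 × Fin 3) (Fin 3 × Fin 3) ℂ)) =
    ((1 / (3 * (8 - 3 * a)) : ℝ) : ℂ) •
      ((∑ i, ((1/4 : ℝ) : ℂ) • (Q i 1 + Q i Complex.I + Q i (-1) + Q i (-Complex.I))) +
      (((2 * b + c - 1 : ℝ) : ℂ) • ∑ i, E i (i + 1)) +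
      (((2 * c + b - 1 : ℝ) : ℂ) • ∑ i, E i (i + 2))) := by
  have hne : (8 - 3 * a) ≠ 0 := by nlinarith
  have hD : 2 + 3 * (2 - a) = 8 - 3 * a := by ring
  have e1 : 1 - 3 * (2 - a) / (8 - 3 * a) = 2 / (8 - 3 * a) := by field_simp; ring
  have hc : c = 2 - a - b := by linarith
  simp only [Q_sum, E_eq, Fin.sum_univ_three, hD, e1]
  have k1 : (2 / (8 - 3 * a)) * (a / (a + b + c) / 3) + 3 * (2 - a) / (8 - 3 * a) / 9
      = 1 / (3 * (8 - 3 * a)) * 2 := by rw [hsum]; field_simp; ring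
  have k2 : (2 / (8 - 3 * a)) * (b / (a + b + c) / 3) + 3 * (2 - a) / (8 - 3 * a) / 9
      = 1 / (3 * (8 - 3 * a)) * (1 + (2 * b + c - 1)) := by
    rw [hsum]; field_simp; rw [hc]; ring
  have k3 : (2 / (8 - 3 * a)) * (c / (a + b + c) / 3) + 3 * (2 - a) / (8 - 3 * a) / 9
      = 1 / (3 * (8 - 3 * a)) * (1 + (2 * c + b - 1)) := by
    rw [hsum]; field_simp; rw [hc]; ring
  have k4 : (2 / (8 - 3 * a)) * (-(1 / (a + b + c)) / 3)
      = 1 / (3 * (8 - 3 * a)) * (-1) := by rw [hsum]; field_simp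
  have c1 := congrArg (fun r : ℝ => (r : ℂ)) k1
  have c2 := congrArg (fun r : ℝ => (r : ℂ)) k2
  have c3 := congrArg (fun r : ℝ => (r : ℂ)) k3
  have c4 := congrArg (fun r : ℝ => (r : ℂ)) k4
  simp only [Complex.ofReal_mul, Complex.ofReal_add _ (3 * (2 - a) / (8 - 3 * a) / 9),
    Complex.ofReal_add 1 _, Complex.ofReal_one, Complex.ofReal_neg 1, Complex.ofReal_ofNat] at c1 c2 c3 c4
  unfold Wmat
  generalize ((2 / (8 - 3 * a) : ℝ) : ℂ) = u at *
  generalize ((1 / (3 * (8 - 3 * a)) : ℝ) : ℂ) = t at *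
  generalize ((3 * (2 - a) / (8 - 3 * a) / 9 : ℝ) : ℂ) = v at *
  generalize ((a / (a + b + c) / 3 : ℝ) : ℂ) = w1 at *
  generalize ((b / (a + b + c) / 3 : ℝ) : ℂ) = w2 at *
  generalize ((c / (a + b + c) / 3 : ℝ) : ℂ) = w3 at *
  generalize ((-(1 / (a + b + c)) / 3 : ℝ) : ℂ) = w4 at *
  generalize ((2 * b + c - 1 : ℝ) : ℂ) = z1 at *
  generalize ((2 * c + b - 1 : ℝ) : ℂ) = z2 at *
  clear k1 k2 k3 k4
  ext ⟨p, p'⟩ ⟨q, q'⟩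
  simp only [Matrix.smul_apply, Matrix.add_apply, Matrix.of_apply, Matrix.one_apply, smul_eq_mul]
  fin_cases p <;> fin_cases p' <;> fin_cases q <;> fin_cases q' <;>
    simp [Fin.ext_iff] <;> first | linear_combination c1 | linear_combination c2 | linear_combination c3 | linear_combination c4

theorem stmt13 (a b c : ℝ) (ha : 0 ≤ a) (hb : 0 ≤ b) (hc : 0 ≤ c)
    (hsum : a + b + c = 2) (h1 : 1 ≤ 2 * b + c) (h2 : 1 ≤ 2 * c + b) :
    Separable (((1 - 3 * (2 - a) / (2 + 3 * (2 - a)) : ℝ) : ℂ) • Wmat a b c +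
        ((3 * (2 - a) / (2 + 3 * (2 - a)) / 9 : ℝ) : ℂ) •
          (1 : Matrix (Fin 3 × Fin 3) (Fin 3 × Fin 3) ℂ)) ∧
      (((1 - 3 * (2 - a) / (2 + 3 * (2 - a)) : ℝ) : ℂ) • Wmat a b c +
        ((3 * (2 - a) / (2 + 3 * (2 - a)) / 9 : ℝ) : ℂ) •
          (1 : Matrix (Fin 3 × Fin 3) (Fin 3 × Fin 3) ℂ)).PosSemidef := by
  rw [decomp_s13 a b c (by linarith) hsum]
  have h : Separable (((1 / (3 * (8 - 3 * a)) : ℝ) : ℂ) •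
      ((∑ i, ((1/4 : ℝ) : ℂ) • (Q i 1 + Q i Complex.I + Q i (-1) + Q i (-Complex.I))) +
      (((2 * b + c - 1 : ℝ) : ℂ) • ∑ i, E i (i + 1)) +
      (((2 * c + b - 1 : ℝ) : ℂ) • ∑ i, E i (i + 2)))) := by
    refine sep_smul _ (div_nonneg zero_le_one (by linarith)) (sep_add (sep_add ?_ ?_) ?_)
    · refine sep_sum _ _ fun i => sep_smul _ (by norm_num) ?_
      exact sep_add (sep_add (sep_add (sep_PT _ _) (sep_PT _ _)) (sep_PT _ _)) (sep_PT _ _)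
    · exact sep_smul _ (by linarith) (sep_sum _ _ fun i => sep_PT _ _)
    · exact sep_smul _ (by linarith) (sep_sum _ _ fun i => sep_PT _ _)
  exact ⟨h, sep_psd h⟩
end

section
/- Let a, b, c be real numbers with a, b, c ≥ 0, a + b + c = 2, and bc ≥ (1 − a)². Then the linear map Φ̃[a,b,c] on M₃(ℂ) is positive: it maps every positive semidefinite 3×3 matrix to a positive semidefinite matrix. -/
open scoped ComplexOrder

/-- The map `Φ̃[a,b,c]` on `M₃(ℂ)`: `Φ̃[a,b,c](X) = N·(D̃[a,b,c](X) − X)` with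
`N = 1/(a+b+c)`. -/
noncomputable def Phit (a b c : ℝ) (X : Matrix (Fin 3) (Fin 3) ℂ) :
    Matrix (Fin 3) (Fin 3) ℂ :=
  (((a + b + c)⁻¹ : ℝ) : ℂ) •
    (Matrix.diagonal
      (![((a : ℂ) + 1) * X 0 0 + (b : ℂ) * X 1 1 + (c : ℂ) * X 2 2,
        (b : ℂ) * X 0 0 + ((c : ℂ) + 1) * X 1 1 + (a : ℂ) * X 2 2,
        (c : ℂ) * X 0 0 + (a : ℂ) * X 1 1 + ((b : ℂ) + 1) * X 2 2] : Fin 3 → ℂ) - X)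

theorem kmat_psd (a b c : ℝ) (ha : 0 ≤ a) (hb : 0 ≤ b) (hc : 0 ≤ c)
    (hsum : a + b + c = 2) (hell : (1 - a) ^ 2 ≤ b * c) :
    (!![(a : ℂ), (b : ℂ) - 1, (c : ℂ) - 1; (b : ℂ) - 1, (c : ℂ), (a : ℂ) - 1;
      (c : ℂ) - 1, (a : ℂ) - 1, (b : ℂ)]).PosSemidef := by
  have key : ∀ (α β x y z : ℝ), 0 ≤ α → 0 ≤ β →
      ((α : ℂ) • Matrix.vecMulVec ![(x : ℂ), y, z] (star ![(x : ℂ), y, z]) +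
       (β : ℂ) • Matrix.vecMulVec ![(0 : ℂ), 1, -1] (star ![(0 : ℂ), 1, -1])).PosSemidef := by
    intro α β x y z h1 h2
    exact ((Matrix.posSemidef_vecMulVec_self_star _).smul (by exact_mod_cast h1)).add
      ((Matrix.posSemidef_vecMulVec_self_star _).smul (by exact_mod_cast h2))
  have hC : (c : ℂ) = 2 - a - b := by
    have : c = 2 - a - b := by linarith
    rw [this]; push_cast; ring
  rcases ha.eq_or_lt with h0 | h0
  · subst h0
    have hb1 : b = 1 := by
      have : c = 2 - b := by linarith
      subst this
      nlinarith [sq_nonneg (b - 1)]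
    subst hb1
    convert key 0 1 0 0 0 le_rfl zero_le_one using 1
    ext i j
    simp only [Matrix.add_apply, Matrix.smul_apply, Matrix.vecMulVec_apply, Pi.star_apply]
    fin_cases i <;> fin_cases j <;> simp [hC] <;> norm_num
  · have hβ : 0 ≤ (a * c - (b - 1) ^ 2) / a := by
      apply div_nonneg _ h0.le
      have : c = 2 - a - b := by linarith
      subst this
      nlinarith
    convert key (1 / a) _ a (b - 1) (c - 1) (by positivity) hβ using 1
    have ha' : (a : ℂ) ≠ 0 := by exact_mod_cast h0.ne'
    ext i j
    simp only [Matrix.add_apply, Matrix.smul_apply, Matrix.vecMulVec_apply, Pi.star_apply]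
    fin_cases i <;> fin_cases j <;> simp [hC] <;> field_simp <;> ring

/-- for `a, b, c ≥ 0` with `a + b + c = 2` and `bc ≥ (1−a)²`,
the map `Φ̃[a,b,c]` is positive. -/
theorem stmt15 (a b c : ℝ) (ha : 0 ≤ a) (hb : 0 ≤ b) (hc : 0 ≤ c)
    (hsum : a + b + c = 2) (hell : (1 - a) ^ 2 ≤ b * c)
    (X : Matrix (Fin 3) (Fin 3) ℂ) (hX : X.PosSemidef) :
    (Phit a b c X).PosSemidef := by
  have e12 := hX.transpose.mul_mul_conjTranspose_same !![(0 : ℂ), 1, 0; -1, 0, 0; 0, 0, 0]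
  have e13 := hX.transpose.mul_mul_conjTranspose_same !![(0 : ℂ), 0, 1; 0, 0, 0; -1, 0, 0]
  have e23 := hX.transpose.mul_mul_conjTranspose_same !![(0 : ℂ), 0, 0; 0, 0, 1; 0, -1, 0]
  have hK : (Matrix.hadamard !![(a : ℂ), (b : ℂ) - 1, (c : ℂ) - 1; (b : ℂ) - 1, (c : ℂ), (a : ℂ) - 1;
      (c : ℂ) - 1, (a : ℂ) - 1, (b : ℂ)] X).PosSemidef := (kmat_psd a b c ha hb hc hsum hell).hadamard hX
  have hT := (((hK.add (e12.smul (a := (b : ℂ)) (by exact_mod_cast hb))).add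
    (e13.smul (a := (c : ℂ)) (by exact_mod_cast hc))).add
    (e23.smul (a := (a : ℂ)) (by exact_mod_cast ha)))
  have hN : (0 : ℂ) ≤ (((a + b + c)⁻¹ : ℝ) : ℂ) := by
    rw [hsum]; exact_mod_cast (by norm_num : (0 : ℝ) ≤ 2⁻¹)
  unfold Phit
  refine Eq.subst (motive := fun M => Matrix.PosSemidef (_ • M)) ?_ (hT.smul hN)
  ext i j
  simp only [Matrix.add_apply, Matrix.sub_apply, Matrix.smul_apply, Matrix.mul_apply,
    Fin.sum_univ_three, Matrix.hadamard_apply, Matrix.transpose_apply,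
    Matrix.conjTranspose_apply, Matrix.diagonal_apply]
  fin_cases i <;> fin_cases j <;> simp <;> ring
end

section
/- Let a, b, c be real numbers with a, b, c ≥ 0, a + b + c = 2, and bc = (1 − a)². Then the real symmetric 3×3 matrix M = [[a, b−1, c−1], [b−1, c, a−1], [c−1, a−1, b]] is positive semidefinite and its eigenvalues are 2, 0, 0; equivalently, its characteristic polynomial is λ²(λ − 2). -/
open scoped ComplexOrder

/-- if `a + b + c = 2` and `bc = (1 − a)²`, then the real
symmetric matrix `M = [[a, b−1, c−1], [b−1, c, a−1], [c−1, a−1, b]]` is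
positive semidefinite and its characteristic polynomial is `λ²(λ − 2)`
(eigenvalues `2, 0, 0`). -/
theorem stmt18 (a b c : ℝ) (hsum : a + b + c = 2) (hbc : b * c = (1 - a) ^ 2) :
    (!![a, b - 1, c - 1; b - 1, c, a - 1; c - 1, a - 1, b] :
        Matrix (Fin 3) (Fin 3) ℝ).PosSemidef ∧
      (!![a, b - 1, c - 1; b - 1, c, a - 1; c - 1, a - 1, b] :
          Matrix (Fin 3) (Fin 3) ℝ).charpoly =
        Polynomial.X ^ 2 * (Polynomial.X - Polynomial.C 2) := by
  have h1 : a * c = (1 - b) ^ 2 := by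
    obtain rfl : c = 2 - a - b := by linarith
    linarith
  have h2 : a * b = (1 - c) ^ 2 := by
    obtain rfl : c = 2 - a - b := by linarith
    linarith
  have hd : a * (c * b - (a - 1) ^ 2) - (b - 1) * ((b - 1) * b - (a - 1) * (c - 1))
      + (c - 1) * ((b - 1) * (a - 1) - c * (c - 1)) = 0 := by
    obtain rfl : c = 2 - a - b := by linarith
    grind
  constructor
  · have hM : (!![a, b - 1, c - 1; b - 1, c, a - 1; c - 1, a - 1, b] :
        Matrix (Fin 3) (Fin 3) ℝ) = (1 / 2 : ℝ) •
        ((!![a, b - 1, c - 1; b - 1, c, a - 1; c - 1, a - 1, b] :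
          Matrix (Fin 3) (Fin 3) ℝ) *
        (!![a, b - 1, c - 1; b - 1, c, a - 1; c - 1, a - 1, b] :
          Matrix (Fin 3) (Fin 3) ℝ).conjTranspose) := by
      ext i j
      fin_cases i <;> fin_cases j <;>
        simp [Matrix.vecMul, dotProduct, Matrix.mul_apply, Fin.sum_univ_three] <;> grind
    rw [hM]
    exact (Matrix.posSemidef_self_mul_conjTranspose _).smul (by norm_num)
  · have e1 := congrArg (Polynomial.C (R := ℝ)) hsum
    have e2 := congrArg (Polynomial.C (R := ℝ)) hbc
    have e3 := congrArg (Polynomial.C (R := ℝ)) h1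
    have e4 := congrArg (Polynomial.C (R := ℝ)) h2
    have e5 := congrArg (Polynomial.C (R := ℝ)) hd
    simp only [map_add, map_sub, map_mul, map_pow, map_one, map_zero] at e1 e2 e3 e4 e5
    rw [Matrix.charpoly, Matrix.det_fin_three]
    simp [Matrix.charmatrix_apply]
    linear_combination (-Polynomial.X ^ 2) * e1 + Polynomial.X * (e2 + e3 + e4) - e5
end
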